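/- There exists an absolute constant c ≥ 1 such that for every integer n ≥ 1 and every z ∈ ℝ² with ‖z‖ ≤ 1 − 2⁻⁶n⁻²: c⁻¹·n⁻²·(1 − ‖z‖)^{1/2} ≤ λₙ(z, B) ≤ c·n⁻²·(1 − ‖z‖)^{1/2}, where B is the closed unit ball of ℝ². -/

import Mathlib

open MeasureTheory Set Pointwise

noncomputable section

abbrev E (d : ℕ) := EuclideanSpace ℝ (Fin d)
abbrev E2 := EuclideanSpace ℝ (Fin 2)

/-- The Christoffel function `λ_n(x, D)` for Lebesgue measure on `D ⊆ ℝ^d`. -/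
noncomputable def christoffel (d n : ℕ) (x : E d) (D : Set (E d)) : ℝ :=
  sInf { r : ℝ | ∃ p : MvPolynomial (Fin d) ℝ, p.totalDegree ≤ n ∧
    MvPolynomial.eval (fun i => x i) p = 1 ∧
    r = ∫ y in D, (MvPolynomial.eval (fun i => y i) p) ^ 2 }

/-- Determinant of the linear part of an affine automorphism of `ℝ^d`. -/
noncomputable def adet {d : ℕ} (T : E d ≃ᵃ[ℝ] E d) : ℝ :=
  LinearMap.det (T.linear : E d →ₗ[ℝ] E d)

/-- The closed unit ball `B` of `ℝ²`. -/
def ballE : Set E2 := Metric.closedBall 0 1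

/-- The unit square `S = [0,1]²` in `ℝ²`. -/
def squareS : Set E2 := {y : E2 | y 0 ∈ Icc (0:ℝ) 1 ∧ y 1 ∈ Icc (0:ℝ) 1}

/-- The geometric quantity `L(x, D)`. -/
noncomputable def Lfun (x : E2) (D : Set E2) : ℝ :=
  sSup { r : ℝ | ∃ T : E2 ≃ᵃ[ℝ] E2, x ∈ T '' ballE ∧ T '' ballE ⊆ D ∧
    r = Real.sqrt (1 - ‖T.symm x‖) * |adet T| }

/-- The geometric quantity `U(x, D)`. -/
noncomputable def Ufun (x : E2) (D : Set E2) : ℝ :=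
  sInf { r : ℝ | ∃ T : E2 ≃ᵃ[ℝ] E2, x ∈ T '' ((2:ℝ)⁻¹ • squareS) ∧ D ⊆ T '' squareS ∧
    r = Real.sqrt ((T.symm x) 0 * (T.symm x) 1) * |adet T| }

/-- A convex body in `ℝ²`: a compact convex set with nonempty interior. -/
def IsConvexBody (D : Set E2) : Prop := Convex ℝ D ∧ IsCompact D ∧ (interior D).Nonempty

/-- The point `(a, b)` of `ℝ²`. -/
noncomputable def e2 (a b : ℝ) : E2 := (WithLp.equiv 2 (Fin 2 → ℝ)).symm ![a, b]

/-- The real function `g` on the circle is a trigonometric polynomial of degree at most `N`. -/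
def TrigPoly (N : ℕ) (g : ℝ → ℝ) : Prop :=
  ∃ P : Polynomial ℂ, P.natDegree ≤ 2 * N ∧
    ∀ θ : ℝ, (g θ : ℂ) * Complex.exp (θ * Complex.I) ^ N = P.eval (Complex.exp (θ * Complex.I))

namespace TrigPoly

open Polynomial

lemma const (c : ℝ) : TrigPoly 0 (fun _ => c) :=
  ⟨C (c : ℂ), by simp, by simp⟩

lemma mono {N M : ℕ} {g : ℝ → ℝ} (hg : TrigPoly N g) (h : N ≤ M) : TrigPoly M g := by
  obtain ⟨P, hP, hg⟩ := hg
  obtain ⟨k, rfl⟩ := Nat.exists_eq_add_of_le h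
  refine ⟨P * X ^ k, ?_, fun θ => ?_⟩
  · refine natDegree_mul_le.trans ?_
    rw [natDegree_X_pow]
    lia
  · rw [pow_add, ← mul_assoc, hg]
    simp

lemma add {N : ℕ} {f g : ℝ → ℝ} (hf : TrigPoly N f) (hg : TrigPoly N g) :
    TrigPoly N (fun θ => f θ + g θ) := by
  obtain ⟨P, hP, hf⟩ := hf
  obtain ⟨Q, hQ, hg⟩ := hg
  refine ⟨P + Q, (natDegree_add_le _ _).trans (max_le hP hQ), fun θ => ?_⟩
  rw [Polynomial.eval_add, ← hf, ← hg]
  push_cast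
  ring

lemma mul {N M : ℕ} {f g : ℝ → ℝ} (hf : TrigPoly N f) (hg : TrigPoly M g) :
    TrigPoly (N + M) (fun θ => f θ * g θ) := by
  obtain ⟨P, hP, hf⟩ := hf
  obtain ⟨Q, hQ, hg⟩ := hg
  refine ⟨P * Q, natDegree_mul_le.trans (by lia), fun θ => ?_⟩
  rw [Polynomial.eval_mul, ← hf, ← hg]
  push_cast
  ring

lemma pow {N : ℕ} {f : ℝ → ℝ} (hf : TrigPoly N f) (k : ℕ) :
    TrigPoly (k * N) (fun θ => f θ ^ k) := by
  induction k with
  | zero => simpa using const 1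
  | succ k ih => simpa [pow_succ, add_mul] using ih.mul hf

lemma const_mul {N : ℕ} {f : ℝ → ℝ} (c : ℝ) (hf : TrigPoly N f) :
    TrigPoly N (fun θ => c * f θ) := by
  simpa using (const c).mul hf

lemma sum {ι : Type*} (s : Finset ι) {N : ℕ} {f : ι → ℝ → ℝ} (hf : ∀ i ∈ s, TrigPoly N (f i)) :
    TrigPoly N (fun θ => ∑ i ∈ s, f i θ) := by
  classical
  induction s using Finset.induction_on with
  | empty => simpa using (const 0).mono (Nat.zero_le N)
  | insert i s hi ih =>
    simp only [Finset.sum_insert hi]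
    exact (hf i (by simp)).add (ih fun j hj => hf j (by simp [hj]))

lemma cos_sub_mul_add (N j k : ℕ) (hj : j ≤ N) (hk : k ≤ N) (c : ℝ) :
    TrigPoly N (fun θ => Real.cos (((j : ℝ) - k) * θ + c)) := by
  refine ⟨C (Complex.exp (c * Complex.I) / 2) * X ^ (N - k + j) +
    C (Complex.exp (-(c * Complex.I)) / 2) * X ^ (N - j + k), ?_, fun θ => ?_⟩
  · refine (natDegree_add_le _ _).trans (max_le ?_ ?_)
    · exact (natDegree_C_mul_X_pow_le _ _).trans (by lia)
    · exact (natDegree_C_mul_X_pow_le _ _).trans (by lia)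
  · simp only [eval_add, eval_mul, eval_C, eval_pow, eval_X, ← Complex.exp_nat_mul]
    rw [Complex.ofReal_cos, Complex.cos]
    push_cast [Nat.cast_sub hj, Nat.cast_sub hk]
    rw [div_mul_eq_mul_div, div_mul_eq_mul_div, ← Complex.exp_add, div_mul_eq_mul_div, add_mul,
      ← Complex.exp_add, ← Complex.exp_add, ← Complex.exp_add, add_div]
    congr 3 <;> ring

lemma cos : TrigPoly 1 Real.cos := by
  simpa using cos_sub_mul_add 1 1 0 le_rfl zero_le_one 0

lemma sin : TrigPoly 1 Real.sin := by
  simpa [← sub_eq_add_neg, Real.cos_sub_pi_div_two] using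
    cos_sub_mul_add 1 1 0 le_rfl zero_le_one (-(Real.pi / 2))

lemma eval_mvPolynomial {σ : Type*} {n : ℕ} (p : MvPolynomial σ ℝ) (hp : p.totalDegree ≤ n)
    {g : ℝ → σ → ℝ} (hg : ∀ i, TrigPoly 1 (fun θ => g θ i)) :
    TrigPoly n (fun θ => MvPolynomial.eval (g θ) p) := by
  simp only [MvPolynomial.eval_eq]
  refine sum _ fun d hd => const_mul _ ?_
  have hdeg : ∑ i ∈ d.support, d i ≤ n := (MvPolynomial.le_totalDegree hd).trans hp
  refine mono ?_ hdeg
  generalize d.support = s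
  classical
  induction s using Finset.induction_on with
  | empty => simpa using const 1
  | insert i s hi ih =>
    simp only [Finset.prod_insert hi, Finset.sum_insert hi]
    exact (by simpa using (hg i).pow (d i) : TrigPoly (d i) _).mul ih

end TrigPoly

lemma integral_norm_sq_eval_exp (P : Polynomial ℂ) :
    ∫ θ in (-Real.pi)..Real.pi, ‖P.eval (Complex.exp (θ * Complex.I))‖ ^ 2 =
      2 * Real.pi * ∑ i ∈ P.support, ‖P.coeff i‖ ^ 2 := by
  have h := P.sum_sq_norm_coeff_eq_circleAverage
  rw [h, Real.circleAverage_def]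
  have hper : Function.Periodic
      (fun θ : ℝ => ‖P.eval (Complex.exp (θ * Complex.I))‖ ^ 2) (2 * Real.pi) := by
    intro θ
    have : Complex.exp (((θ + 2 * Real.pi : ℝ) : ℂ) * Complex.I) =
        Complex.exp (θ * Complex.I) := by
      push_cast
      rw [add_mul, Complex.exp_add, Complex.exp_two_pi_mul_I, mul_one]
    simp only [this]
  have := hper.intervalIntegral_add_eq (-Real.pi) 0
  rw [show -Real.pi + 2 * Real.pi = Real.pi by ring, zero_add] at this
  rw [this]
  simp only [circleMap, zero_add, Complex.ofReal_one, one_mul, smul_eq_mul]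
  rw [mul_inv_cancel_left₀ (by positivity)]

/-- The `L²` Nikolskii inequality for trigonometric polynomials. -/
lemma TrigPoly.sq_le_integral {N : ℕ} {g : ℝ → ℝ} (hg : TrigPoly N g) (φ : ℝ) :
    2 * Real.pi * g φ ^ 2 ≤ (2 * N + 1) * ∫ θ in (-Real.pi)..Real.pi, g θ ^ 2 := by
  obtain ⟨P, hP, hg⟩ := hg
  have hnorm : ∀ θ : ℝ, g θ ^ 2 = ‖P.eval (Complex.exp (θ * Complex.I))‖ ^ 2 := by
    intro θ
    rw [← hg θ, norm_mul, norm_pow, Complex.norm_exp_ofReal_mul_I]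
    simp
  simp only [hnorm]
  rw [integral_norm_sq_eval_exp, mul_left_comm]
  refine mul_le_mul_of_nonneg_left ?_ (by positivity)
  set w := Complex.exp (φ * Complex.I) with hw
  have hw1 : ‖w‖ = 1 := Complex.norm_exp_ofReal_mul_I φ
  rw [Polynomial.eval_eq_sum, Polynomial.sum]
  have h1 : ‖∑ i ∈ P.support, P.coeff i * w ^ i‖ ≤ ∑ i ∈ P.support, ‖P.coeff i‖ := by
    refine (norm_sum_le _ _).trans (le_of_eq ?_)
    simp [hw1]
  have h2 : (P.support.card : ℝ) ≤ 2 * N + 1 := by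
    have := Polynomial.card_supp_le_succ_natDegree P
    exact_mod_cast this.trans (by lia)
  calc ‖∑ i ∈ P.support, P.coeff i * w ^ i‖ ^ 2
      ≤ (∑ i ∈ P.support, ‖P.coeff i‖) ^ 2 := by gcongr
    _ ≤ P.support.card * ∑ i ∈ P.support, ‖P.coeff i‖ ^ 2 := sq_sum_le_card_mul_sum_sq
    _ ≤ _ := by gcongr

/-- The Fejér kernel of order `m`, normalised to take the value `1` at `0`. -/
def fejer (m : ℕ) (u : ℝ) : ℝ :=
  ‖∑ j ∈ Finset.range m, Complex.exp (u * Complex.I) ^ j‖ ^ 2 / (m : ℝ) ^ 2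

section Fejer

variable (m : ℕ) (u : ℝ)

lemma fejer_nonneg : 0 ≤ fejer m u := by
  unfold fejer
  positivity

lemma norm_sum_exp_pow_le :
    ‖∑ j ∈ Finset.range m, Complex.exp (u * Complex.I) ^ j‖ ≤ m := by
  refine (norm_sum_le _ _).trans (le_of_eq ?_)
  simp [Complex.norm_exp_ofReal_mul_I]

lemma fejer_le_one : fejer m u ≤ 1 := by
  unfold fejer
  refine div_le_one_of_le₀ ?_ (by positivity)
  gcongr
  exact norm_sum_exp_pow_le m u

lemma fejer_zero (hm : m ≠ 0) : fejer m 0 = 1 := by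
  simp [fejer, hm]

lemma fejer_continuous : Continuous (fejer m) := by
  unfold fejer
  fun_prop

lemma abs_sin_mul_fejer_le : |Real.sin u| * fejer m u ≤ 2 / m := by
  rcases Nat.eq_zero_or_pos m with rfl | hm
  · simp [fejer]
  have hm' : (0 : ℝ) < m := by exact_mod_cast hm
  set w := Complex.exp (u * Complex.I) with hw
  have hw1 : ‖w‖ = 1 := Complex.norm_exp_ofReal_mul_I u
  have h1 : |Real.sin u| ≤ ‖w - 1‖ := by
    have := Complex.abs_im_le_norm (w - 1)
    simpa [hw, Complex.exp_ofReal_mul_I_im] using this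
  set S := ∑ j ∈ Finset.range m, w ^ j with hS
  have h2 : ‖w - 1‖ * ‖S‖ ≤ 2 := by
    rw [← norm_mul, mul_comm, hS, geom_sum_mul]
    refine (norm_sub_le _ _).trans (le_of_eq ?_)
    rw [norm_pow, hw1]
    norm_num
  have h3 : ‖S‖ ≤ m := norm_sum_exp_pow_le m u
  have : fejer m u = ‖S‖ ^ 2 / (m : ℝ) ^ 2 := rfl
  rw [this, ← mul_div_assoc, div_le_div_iff₀ (by positivity) hm']
  have h4 : |Real.sin u| * ‖S‖ ^ 2 ≤ 2 * m := by
    calc |Real.sin u| * ‖S‖ ^ 2 ≤ ‖w - 1‖ * ‖S‖ ^ 2 := by gcongr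
      _ = (‖w - 1‖ * ‖S‖) * ‖S‖ := by ring
      _ ≤ 2 * m := by gcongr
  nlinarith

lemma fejer_eq_sum : fejer m u =
    ((m : ℝ) ^ 2)⁻¹ * ∑ j ∈ Finset.range m, ∑ k ∈ Finset.range m, Real.cos (((j : ℝ) - k) * u) := by
  have hre : ∀ j : ℕ, Complex.exp (u * Complex.I) ^ j =
      (Real.cos (j * u) : ℂ) + (Real.sin (j * u) : ℂ) * Complex.I := by
    intro j
    rw [← Complex.exp_nat_mul, Complex.ofReal_cos, Complex.ofReal_sin, ← Complex.exp_mul_I]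
    push_cast
    ring_nf
  have : ‖∑ j ∈ Finset.range m, Complex.exp (u * Complex.I) ^ j‖ ^ 2 =
      (∑ j ∈ Finset.range m, Real.cos (j * u)) ^ 2 +
        (∑ j ∈ Finset.range m, Real.sin (j * u)) ^ 2 := by
    simp only [hre, Finset.sum_add_distrib, ← Finset.sum_mul, ← Complex.ofReal_sum]
    rw [← Complex.normSq_eq_norm_sq, Complex.normSq_add_mul_I]
  rw [fejer, this, sq, sq (∑ j ∈ Finset.range m, Real.sin _), Finset.sum_mul_sum,
    Finset.sum_mul_sum, ← Finset.sum_add_distrib, div_eq_inv_mul]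
  simp only [← Finset.sum_add_distrib, sub_mul, Real.cos_sub]

lemma TrigPoly.fejer_sub (φ : ℝ) : TrigPoly (m - 1) (fun θ => fejer m (θ - φ)) := by
  simp only [fejer_eq_sum]
  refine const_mul _ (sum _ fun j hj => sum _ fun k hk => ?_)
  have hj := Finset.mem_range.1 hj
  have hk := Finset.mem_range.1 hk
  simpa only [mul_sub, ← sub_eq_add_neg] using
    cos_sub_mul_add (m - 1) j k (by lia) (by lia) (-(((j : ℝ) - k) * φ))

lemma integral_fejer_sub (φ : ℝ) :
    ∫ θ in (-Real.pi)..Real.pi, fejer m (θ - φ) = 2 * Real.pi / m := by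
  have hper : Function.Periodic (fejer m) (2 * Real.pi) := by
    intro θ
    have : Complex.exp (((θ + 2 * Real.pi : ℝ) : ℂ) * Complex.I) =
        Complex.exp (θ * Complex.I) := by
      push_cast
      rw [add_mul, Complex.exp_add, Complex.exp_two_pi_mul_I, mul_one]
    simp only [fejer, this]
  rw [intervalIntegral.integral_comp_sub_right (fejer m) φ]
  have := hper.intervalIntegral_add_eq (-Real.pi - φ) (-Real.pi)
  rw [show -Real.pi - φ + 2 * Real.pi = Real.pi - φ by ring,
    show -Real.pi + 2 * Real.pi = Real.pi by ring] at this
  rw [this]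
  have h := integral_norm_sq_eval_exp (∑ j ∈ Finset.range m, Polynomial.X ^ j)
  have hc : ∀ i, (∑ j ∈ Finset.range m, (Polynomial.X : Polynomial ℂ) ^ j).coeff i =
      if i < m then 1 else 0 := by
    intro i
    simp [Polynomial.coeff_X_pow]
  have hs : (∑ j ∈ Finset.range m, (Polynomial.X : Polynomial ℂ) ^ j).support =
      Finset.range m := by
    ext i
    simp [hc]
  rw [hs, Finset.sum_congr rfl (g := fun _ => (1 : ℝ))
    (fun i hi => by simp [hc, Finset.mem_range.1 hi])] at h
  simp only [Polynomial.eval_finsetSum, Polynomial.eval_pow, Polynomial.eval_X,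
    Finset.sum_const, Finset.card_range, nsmul_eq_mul, mul_one] at h
  simp only [fejer, intervalIntegral.integral_div, h]
  rcases Nat.eq_zero_or_pos m with rfl | hm
  · simp
  field_simp

lemma fejer_sq_mul_abs_sin_le (θ φ : ℝ) :
    fejer m (θ - φ) ^ 2 * |Real.sin θ| ≤ fejer m (θ - φ) * (|Real.sin φ| + 2 / m) := by
  set F := fejer m (θ - φ) with hF
  have h0 : 0 ≤ F := fejer_nonneg _ _
  have h1 : F ≤ 1 := fejer_le_one _ _
  have h2 : |Real.sin (θ - φ)| * F ≤ 2 / m := abs_sin_mul_fejer_le m _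
  have h3 : |Real.sin θ| ≤ |Real.sin φ| + |Real.sin (θ - φ)| := by
    have : Real.sin θ = Real.sin (θ - φ) * Real.cos φ + Real.cos (θ - φ) * Real.sin φ := by
      rw [← Real.sin_add, sub_add_cancel]
    rw [this, add_comm |Real.sin φ|]
    refine (abs_add_le _ _).trans (add_le_add ?_ ?_)
    · rw [abs_mul]
      exact mul_le_of_le_one_right (abs_nonneg _) (Real.abs_cos_le_one _)
    · rw [abs_mul]
      exact mul_le_of_le_one_left (abs_nonneg _) (Real.abs_cos_le_one _)
  calc F ^ 2 * |Real.sin θ| ≤ F ^ 2 * (|Real.sin φ| + |Real.sin (θ - φ)|) := by gcongr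
    _ = F * (F * |Real.sin φ| + |Real.sin (θ - φ)| * F) := by ring
    _ ≤ F * (1 * |Real.sin φ| + 2 / m) := by gcongr
    _ = _ := by ring

end Fejer

lemma integral_comp_cos_mul_abs_sin {h : ℝ → ℝ} (hh : Continuous h) :
    ∫ θ in (-Real.pi)..Real.pi, h (Real.cos θ) * |Real.sin θ| = 2 * ∫ t in (-1)..1, h t := by
  have hint : ∀ a b : ℝ, IntervalIntegrable (fun θ => h (Real.cos θ) * |Real.sin θ|) volume a b :=
    fun a b => (by fun_prop : Continuous _).intervalIntegrable a b
  have h1 : ∫ θ in (0)..Real.pi, h (Real.cos θ) * |Real.sin θ| = ∫ t in (-1)..1, h t := by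
    have := intervalIntegral.integral_comp_mul_deriv (a := 0) (b := Real.pi)
      (fun x _ => Real.hasDerivAt_cos x) (by fun_prop) hh
    rw [Real.cos_zero, Real.cos_pi, intervalIntegral.integral_symm (-1) 1] at this
    rw [← neg_eq_iff_eq_neg.2 this, ← intervalIntegral.integral_neg]
    refine intervalIntegral.integral_congr fun θ hθ => ?_
    rw [Set.uIcc_of_le Real.pi_pos.le] at hθ
    simp [abs_of_nonneg (Real.sin_nonneg_of_mem_Icc hθ)]
  have h2 : ∫ θ in (-Real.pi)..0, h (Real.cos θ) * |Real.sin θ| =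
      ∫ θ in (0)..Real.pi, h (Real.cos θ) * |Real.sin θ| := by
    have := intervalIntegral.integral_comp_neg (a := 0) (b := Real.pi)
      (fun θ => h (Real.cos θ) * |Real.sin θ|)
    simpa using this.symm
  rw [← intervalIntegral.integral_add_adjacent_intervals (hint _ 0) (hint 0 _), h2, h1, two_mul]

/-- The polynomial `q` with `q (cos θ) = fejer m (θ - φ) + fejer m (θ + φ)`. -/
lemma exists_polynomial_eval_cos_eq_fejer (m : ℕ) (φ : ℝ) :
    ∃ q : Polynomial ℝ, q.natDegree ≤ m - 1 ∧
      ∀ θ, q.eval (Real.cos θ) = fejer m (θ - φ) + fejer m (θ - -φ) := by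
  refine ⟨Polynomial.C (2 * ((m : ℝ) ^ 2)⁻¹) * ∑ j ∈ Finset.range m, ∑ k ∈ Finset.range m,
    Polynomial.C (Real.cos (((j : ℝ) - k) * φ)) * Polynomial.Chebyshev.T ℝ ((j : ℤ) - k),
    ?_, fun θ => ?_⟩
  · refine (Polynomial.natDegree_C_mul_le _ _).trans ?_
    refine Polynomial.natDegree_sum_le_of_forall_le _ _ fun j hj => ?_
    refine Polynomial.natDegree_sum_le_of_forall_le _ _ fun k hk => ?_
    refine (Polynomial.natDegree_C_mul_le _ _).trans ?_
    rw [Polynomial.Chebyshev.natDegree_T]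
    have := Finset.mem_range.1 hj
    have := Finset.mem_range.1 hk
    lia
  · simp only [Polynomial.eval_mul, Polynomial.eval_C, Polynomial.eval_finsetSum,
      Polynomial.Chebyshev.T_real_cos, fejer_eq_sum]
    rw [← mul_add, ← Finset.sum_add_distrib, mul_comm (2 : ℝ), mul_assoc, Finset.mul_sum]
    congr 1
    refine Finset.sum_congr rfl fun j _ => ?_
    rw [← Finset.sum_add_distrib, Finset.mul_sum]
    refine Finset.sum_congr rfl fun k _ => ?_
    push_cast
    rw [sub_neg_eq_add, mul_sub, mul_add, Real.cos_sub, Real.cos_add]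
    ring

/-- An upper bound for the Christoffel function of `[-1, 1]`. -/
lemma exists_polynomial_integral_sq_le (m : ℕ) (hm : m ≠ 0) {t : ℝ} (ht : t ∈ Icc (-1) 1) :
    ∃ q : Polynomial ℝ, q.natDegree ≤ m - 1 ∧ q.eval t = 1 ∧
      ∫ x in (-1)..1, q.eval x ^ 2 ≤ 4 * Real.pi / m * (√(1 - t ^ 2) + 2 / m) := by
  obtain ⟨q, hdeg, hq⟩ := exists_polynomial_eval_cos_eq_fejer m (Real.arccos t)
  set φ := Real.arccos t with hφ
  have hcos : Real.cos φ = t := Real.cos_arccos ht.1 ht.2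
  have hsin : |Real.sin φ| = √(1 - t ^ 2) := by
    rw [Real.sin_arccos, abs_of_nonneg (Real.sqrt_nonneg _)]
  set A := √(1 - t ^ 2) + 2 / (m : ℝ) with hA
  have hone : 1 ≤ q.eval t := by
    rw [← hcos, hq, sub_self, fejer_zero m hm]
    linarith [fejer_nonneg m (φ - -φ)]
  have hc := fejer_continuous m
  have hqint : ∫ x in (-1)..1, q.eval x ^ 2 ≤ 4 * Real.pi / m * A := by
    have h1 : ∫ θ in (-Real.pi)..Real.pi, q.eval (Real.cos θ) ^ 2 * |Real.sin θ| ≤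
        ∫ θ in (-Real.pi)..Real.pi, (fejer m (θ - φ) * (2 * A) + fejer m (θ - -φ) * (2 * A)) := by
      refine intervalIntegral.integral_mono_on (by linarith [Real.pi_pos])
        ((by fun_prop : Continuous _).intervalIntegrable _ _)
        ((by fun_prop : Continuous _).intervalIntegrable _ _) fun θ _ => ?_
      rw [hq]
      have e1 := fejer_sq_mul_abs_sin_le m θ φ
      have e2 := fejer_sq_mul_abs_sin_le m θ (-φ)
      rw [Real.sin_neg, abs_neg] at e2
      rw [hsin] at e1 e2
      have e3 : (fejer m (θ - φ) + fejer m (θ - -φ)) ^ 2 ≤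
          2 * (fejer m (θ - φ) ^ 2 + fejer m (θ - -φ) ^ 2) := add_sq_le
      have e4 := mul_le_mul_of_nonneg_right e3 (abs_nonneg (Real.sin θ))
      nlinarith
    rw [integral_comp_cos_mul_abs_sin (h := fun x => q.eval x ^ 2) (by fun_prop),
      intervalIntegral.integral_add
        ((by fun_prop : Continuous _).intervalIntegrable _ _)
        ((by fun_prop : Continuous _).intervalIntegrable _ _),
      intervalIntegral.integral_mul_const, intervalIntegral.integral_mul_const,
      integral_fejer_sub, integral_fejer_sub] at h1
    calc _ ≤ 2 * Real.pi / m * (2 * A) := by linarith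
      _ = _ := by ring
  refine ⟨Polynomial.C (q.eval t)⁻¹ * q, (Polynomial.natDegree_C_mul_le _ _).trans hdeg, ?_, ?_⟩
  · rw [Polynomial.eval_mul, Polynomial.eval_C, inv_mul_cancel₀ (by linarith)]
  · simp only [Polynomial.eval_mul, Polynomial.eval_C, mul_pow, intervalIntegral.integral_const_mul]
    refine le_trans (mul_le_of_le_one_left ?_ ?_) hqint
    · exact intervalIntegral.integral_nonneg (by norm_num) fun x _ => by positivity
    · exact pow_le_one₀ (by positivity) (inv_le_one_of_one_le₀ hone)

/-- A lower bound for the Christoffel function of `[-1, 1]`, away from the end points. -/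
lemma sq_mul_sqrt_le_integral {n : ℕ} (hn : 1 ≤ n) {h : ℝ → ℝ} (hh : Continuous h)
    (hp : TrigPoly n (fun θ => h (Real.cos θ))) {t K : ℝ} (ht : t ∈ Ioo (-1) 1)
    (hK : 2 / n ≤ K * √(1 - t ^ 2)) :
    Real.pi * (h t ^ 2 * √(1 - t ^ 2)) ≤ (4 * n + 1) * (1 + K) * ∫ x in (-1)..1, h x ^ 2 := by
  set φ := Real.arccos t with hφ
  have hcos : Real.cos φ = t := Real.cos_arccos ht.1.le ht.2.le
  set s := √(1 - t ^ 2) with hs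
  have hs0 : 0 < s := Real.sqrt_pos.2 (by nlinarith [ht.1, ht.2])
  have hsin : Real.sin φ = s := Real.sin_arccos t
  have hg := (hp.mul TrigPoly.sin).mul (TrigPoly.fejer_sub n φ)
  rw [show n + 1 + (n - 1) = 2 * n by lia] at hg
  have key := hg.sq_le_integral φ
  simp only [hcos, hsin, sub_self, fejer_zero n (by lia), mul_one] at key
  have hc := fejer_continuous n
  have hint : ∫ θ in (-Real.pi)..Real.pi,
        (h (Real.cos θ) * Real.sin θ * fejer n (θ - φ)) ^ 2 ≤
      ∫ θ in (-Real.pi)..Real.pi, ((1 + K) * s) * (h (Real.cos θ) ^ 2 * |Real.sin θ|) := by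
    refine intervalIntegral.integral_mono_on (by linarith [Real.pi_pos])
      ((by fun_prop : Continuous _).intervalIntegrable _ _)
      ((by fun_prop : Continuous _).intervalIntegrable _ _) fun θ _ => ?_
    have e1 := fejer_sq_mul_abs_sin_le n θ φ
    rw [hsin, abs_of_pos hs0] at e1
    have e2 : fejer n (θ - φ) ^ 2 * |Real.sin θ| ≤ (1 + K) * s := by
      refine e1.trans ((mul_le_of_le_one_left ?_ (fejer_le_one _ _)).trans ?_)
      · positivity
      · linarith
    calc (h (Real.cos θ) * Real.sin θ * fejer n (θ - φ)) ^ 2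
        = (fejer n (θ - φ) ^ 2 * |Real.sin θ|) * (h (Real.cos θ) ^ 2 * |Real.sin θ|) := by
          rw [mul_pow, mul_pow, ← sq_abs (Real.sin θ)]
          ring
      _ ≤ _ := by gcongr
  rw [intervalIntegral.integral_const_mul,
    integral_comp_cos_mul_abs_sin (h := fun x => h x ^ 2) (by fun_prop)] at hint
  push_cast at key
  have h2 := key.trans (mul_le_mul_of_nonneg_left hint (by positivity))
  refine le_of_mul_le_mul_left ?_ (by positivity : 0 < 2 * s)
  calc _ = 2 * Real.pi * (h t * s) ^ 2 := by ring
    _ ≤ _ := h2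
    _ = _ := by ring

lemma setIntegral_disc_eq {F : ℝ → ℝ → ℝ} (hF : Continuous (Function.uncurry F)) :
    ∫ w in {w : ℝ × ℝ | w.1 ^ 2 + w.2 ^ 2 ≤ 1}, F w.1 w.2 =
      ∫ y in (-1)..1, √(1 - y ^ 2) * ∫ t in (-1)..1, F (√(1 - y ^ 2) * t) y := by
  have hclosed : IsClosed {w : ℝ × ℝ | w.1 ^ 2 + w.2 ^ 2 ≤ 1} :=
    isClosed_le (by fun_prop) (by fun_prop)
  have hcomp : IsCompact {w : ℝ × ℝ | w.1 ^ 2 + w.2 ^ 2 ≤ 1} := by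
    refine (isCompact_Icc (a := ((-1 : ℝ), (-1 : ℝ))) (b := (1, 1))).of_isClosed_subset hclosed ?_
    intro w hw
    have hw : w.1 ^ 2 + w.2 ^ 2 ≤ 1 := hw
    exact ⟨⟨by nlinarith, by nlinarith⟩, ⟨by nlinarith, by nlinarith⟩⟩
  have hInt : IntegrableOn (fun w : ℝ × ℝ => F w.1 w.2) {w : ℝ × ℝ | w.1 ^ 2 + w.2 ^ 2 ≤ 1} :=
    (hF.continuousOn).integrableOn_compact hcomp
  have hInt' := hInt.integrable_indicator hclosed.measurableSet
  rw [← integral_indicator hclosed.measurableSet, Measure.volume_eq_prod,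
    integral_prod_symm _ hInt']
  have hinner : ∀ y : ℝ, ∫ x, {w : ℝ × ℝ | w.1 ^ 2 + w.2 ^ 2 ≤ 1}.indicator
      (fun w : ℝ × ℝ => F w.1 w.2) (x, y) =
      (Icc (-1 : ℝ) 1).indicator
        (fun y => √(1 - y ^ 2) * ∫ t in (-1)..1, F (√(1 - y ^ 2) * t) y) y := by
    intro y
    by_cases hy : y ∈ Icc (-1 : ℝ) 1
    · rw [indicator_of_mem hy]
      have hy2 : 0 ≤ 1 - y ^ 2 := by nlinarith [hy.1, hy.2]
      have hset : (fun x => {w : ℝ × ℝ | w.1 ^ 2 + w.2 ^ 2 ≤ 1}.indicator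
          (fun w : ℝ × ℝ => F w.1 w.2) (x, y)) =
          (Icc (-√(1 - y ^ 2)) (√(1 - y ^ 2))).indicator (fun x => F x y) := by
        ext x
        have : (x, y) ∈ {w : ℝ × ℝ | w.1 ^ 2 + w.2 ^ 2 ≤ 1} ↔
            x ∈ Icc (-√(1 - y ^ 2)) (√(1 - y ^ 2)) := by
          rw [mem_Icc, ← abs_le]
          constructor
          · intro h
            exact Real.abs_le_sqrt (by simp only [mem_ofPred_eq] at h; linarith)
          · intro h
            have := (Real.le_sqrt (abs_nonneg _) hy2).1 h
            rw [sq_abs] at this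
            simp only [mem_ofPred_eq]
            linarith
        by_cases hx : x ∈ Icc (-√(1 - y ^ 2)) (√(1 - y ^ 2))
        · rw [indicator_of_mem hx, indicator_of_mem (this.2 hx)]
        · rw [indicator_of_notMem hx, indicator_of_notMem (fun h => hx (this.1 h))]
      rw [hset, integral_indicator measurableSet_Icc, integral_Icc_eq_integral_Ioc,
        ← intervalIntegral.integral_of_le (by linarith [Real.sqrt_nonneg (1 - y ^ 2)]),
        intervalIntegral.mul_integral_comp_mul_left (f := fun x => F x y)]
      simp
    · rw [indicator_of_notMem hy]
      refine integral_eq_zero_of_ae (Filter.Eventually.of_forall fun x => ?_)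
      refine indicator_of_notMem (fun h => hy ?_) _
      have h : x ^ 2 + y ^ 2 ≤ 1 := h
      exact ⟨by nlinarith, by nlinarith⟩
  simp only [hinner]
  rw [integral_indicator measurableSet_Icc, integral_Icc_eq_integral_Ioc,
    ← intervalIntegral.integral_of_le (by norm_num)]

lemma two_mul_setIntegral_disc_eq {F : ℝ → ℝ → ℝ} (hF : Continuous (Function.uncurry F)) :
    2 * ∫ w in {w : ℝ × ℝ | w.1 ^ 2 + w.2 ^ 2 ≤ 1}, F w.1 w.2 =
      ∫ α in (-Real.pi)..Real.pi, ∫ t in (-1)..1,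
        F (t * Real.sin α) (Real.cos α) * Real.sin α ^ 2 := by
  have hJ : Continuous fun y : ℝ => √(1 - y ^ 2) * ∫ t in (-1)..1, F (√(1 - y ^ 2) * t) y := by
    refine Continuous.mul (by fun_prop) ?_
    refine intervalIntegral.continuous_parametric_intervalIntegral_of_continuous' ?_ _ _
    exact hF.comp (by fun_prop : Continuous fun p : ℝ × ℝ => (√(1 - p.1 ^ 2) * p.2, p.1))
  rw [setIntegral_disc_eq hF, ← integral_comp_cos_mul_abs_sin hJ]
  refine intervalIntegral.integral_congr fun α _ => ?_
  have habs : √(1 - Real.cos α ^ 2) = |Real.sin α| := (Real.abs_sin_eq_sqrt_one_sub_cos_sq α).symm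
  simp only [habs, intervalIntegral.integral_mul_const]
  have : ∫ t in (-1)..1, F (|Real.sin α| * t) (Real.cos α) =
      ∫ t in (-1)..1, F (t * Real.sin α) (Real.cos α) := by
    rcases abs_choice (Real.sin α) with h | h
    · simp only [h, mul_comm]
    · have := intervalIntegral.integral_comp_neg (a := -1) (b := 1)
        (fun t => F (t * Real.sin α) (Real.cos α))
      rw [neg_neg] at this
      rw [← this, h]
      simp only [neg_mul, mul_neg, mul_comm]
  rw [this, ← sq_abs (Real.sin α)]
  ring

lemma setIntegral_ballE_eq {a b : ℝ} (hab : a ^ 2 + b ^ 2 = 1) (f : ℝ → ℝ → ℝ) :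
    ∫ y in ballE, f (y 0) (y 1) =
      ∫ w in {w : ℝ × ℝ | w.1 ^ 2 + w.2 ^ 2 ≤ 1},
        f (a * w.1 - b * w.2) (b * w.1 + a * w.2) := by
  obtain ⟨u, hu⟩ : ∃ u : Circle, (u : ℂ) = ⟨a, b⟩ := by
    refine ⟨⟨⟨a, b⟩, mem_sphere_zero_iff_norm.2 ?_⟩, rfl⟩
    rw [← sq_eq_sq₀ (norm_nonneg _) zero_le_one, ← Complex.normSq_eq_norm_sq, Complex.normSq_mk]
    linarith
  let R : ℂ ≃ₗᵢ[ℝ] E2 := (rotation u).trans Complex.orthonormalBasisOneI.repr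
  have hR0 : ∀ w : ℂ, (R w) 0 = a * w.re - b * w.im := fun w => by
    simp [R, rotation_apply, Complex.orthonormalBasisOneI_repr_apply, hu]
  have hR1 : ∀ w : ℂ, (R w) 1 = b * w.re + a * w.im := fun w => by
    simp [R, rotation_apply, Complex.orthonormalBasisOneI_repr_apply, hu, add_comm]
  have h1 := R.measurePreserving.setIntegral_preimage_emb
    R.toHomeomorph.measurableEmbedding (fun y : E2 => f (y 0) (y 1)) ballE
  have h2 := Complex.volume_preserving_equiv_real_prod.setIntegral_preimage_emb
    Complex.measurableEquivRealProd.measurableEmbedding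
    (fun w : ℝ × ℝ => f (a * w.1 - b * w.2) (b * w.1 + a * w.2))
    {w : ℝ × ℝ | w.1 ^ 2 + w.2 ^ 2 ≤ 1}
  rw [← h1, ← h2]
  have hset : R ⁻¹' ballE =
      Complex.measurableEquivRealProd ⁻¹' {w : ℝ × ℝ | w.1 ^ 2 + w.2 ^ 2 ≤ 1} := by
    ext w
    simp only [ballE, mem_preimage, mem_closedBall_zero_iff, R.norm_map, mem_ofPred_eq,
      Complex.measurableEquivRealProd_apply]
    rw [← sq_le_one_iff₀ (norm_nonneg _), ← Complex.normSq_eq_norm_sq, Complex.normSq_apply, sq, sq]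
  rw [hset]
  simp only [hR0, hR1, Complex.measurableEquivRealProd_apply]

lemma totalDegree_polynomial_aeval_le {σ : Type*} (q : Polynomial ℝ) {L : MvPolynomial σ ℝ}
    (hL : L.totalDegree ≤ 1) : (Polynomial.aeval L q).totalDegree ≤ q.natDegree := by
  rw [Polynomial.aeval_eq_sum_range]
  refine MvPolynomial.totalDegree_finsetSum_le fun i hi => ?_
  refine (MvPolynomial.totalDegree_smul_le _ _).trans ((MvPolynomial.totalDegree_pow _ _).trans ?_)
  have := Finset.mem_range.1 hi
  nlinarith

lemma eval_polynomial_aeval {σ : Type*} (q : Polynomial ℝ) (L : MvPolynomial σ ℝ) (x : σ → ℝ) :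
    MvPolynomial.eval x (Polynomial.aeval L q) = q.eval (MvPolynomial.eval x L) := by
  rw [Polynomial.aeval_def, Polynomial.hom_eval₂, Polynomial.eval]
  congr 1
  ext c
  simp

lemma totalDegree_linear_le (a b : ℝ) :
    (MvPolynomial.C a * MvPolynomial.X 0 + MvPolynomial.C b * MvPolynomial.X 1 :
      MvPolynomial (Fin 2) ℝ).totalDegree ≤ 1 := by
  refine (MvPolynomial.totalDegree_add _ _).trans (max_le ?_ ?_) <;>
  · refine (MvPolynomial.totalDegree_mul _ _).trans ?_
    simp

lemma exists_polar (z : E2) : ∃ a b : ℝ, a ^ 2 + b ^ 2 = 1 ∧ z 0 = a * ‖z‖ ∧ z 1 = b * ‖z‖ := by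
  have hnorm : ‖z‖ ^ 2 = z 0 ^ 2 + z 1 ^ 2 := by
    simp [EuclideanSpace.norm_sq_eq]
  rcases eq_or_ne z 0 with rfl | hz
  · exact ⟨1, 0, by norm_num, by simp, by simp⟩
  · have hz' : ‖z‖ ≠ 0 := norm_ne_zero_iff.2 hz
    refine ⟨z 0 / ‖z‖, z 1 / ‖z‖, ?_, by field_simp, by field_simp⟩
    rw [div_pow, div_pow, ← add_div, ← hnorm, div_self (by positivity)]

lemma eval_coords (p : MvPolynomial (Fin 2) ℝ) (y : E2) :
    MvPolynomial.eval (fun i => y i) p = MvPolynomial.eval ![y 0, y 1] p := by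
  congr 2
  ext i
  fin_cases i <;> rfl

lemma inv_le_mul_sqrt {n : ℕ} {r : ℝ} (hr : r ≤ 1 - (64 * (n : ℝ) ^ 2)⁻¹) :
    (n : ℝ)⁻¹ ≤ 8 * √(1 - r) := by
  have : (n : ℝ)⁻¹ / 8 ≤ √(1 - r) := by
    refine Real.le_sqrt_of_sq_le ?_
    calc ((n : ℝ)⁻¹ / 8) ^ 2 = (64 * (n : ℝ) ^ 2)⁻¹ := by
          rw [mul_inv, div_pow, inv_pow]
          ring
      _ ≤ _ := by linarith
  linarith

lemma christoffel_ball_upper {n : ℕ} (hn : 1 ≤ n) {z : E2}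
    (hz : ‖z‖ ≤ 1 - (64 * (n : ℝ) ^ 2)⁻¹) :
    ∃ p : MvPolynomial (Fin 2) ℝ, p.totalDegree ≤ n ∧ MvPolynomial.eval (fun i => z i) p = 1 ∧
      ∫ y in ballE, (MvPolynomial.eval (fun i => y i) p) ^ 2 ≤
        70000 * ((n : ℝ) ^ 2)⁻¹ * √(1 - ‖z‖) := by
  obtain ⟨a, b, hab, hz0, hz1⟩ := exists_polar z
  have hn0 : (0 : ℝ) < n := by exact_mod_cast hn
  have hδ := inv_le_mul_sqrt hz
  have hr0 := norm_nonneg z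
  have hr1 : ‖z‖ ≤ 1 := hz.trans (sub_le_self _ (by positivity))
  set r := ‖z‖ with hr
  set m := n / 2 + 1 with hm
  have hm0 : m ≠ 0 := by lia
  have hminv : (m : ℝ)⁻¹ ≤ 2 * (n : ℝ)⁻¹ := by
    have h : (n : ℝ) ≤ 2 * m := by exact_mod_cast (by lia : n ≤ 2 * m)
    rw [← div_eq_mul_inv, inv_le_comm₀ (by positivity) (by positivity), inv_div]
    linarith
  obtain ⟨q, hqd, hq1, hq⟩ := exists_polynomial_integral_sq_le m hm0 (t := r)
    ⟨by linarith, hr1⟩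
  obtain ⟨s, hsd, hs1, hs⟩ := exists_polynomial_integral_sq_le m hm0 (t := 0)
    ⟨by norm_num, by norm_num⟩
  refine ⟨Polynomial.aeval (MvPolynomial.C a * MvPolynomial.X 0 +
      MvPolynomial.C b * MvPolynomial.X 1) q *
    Polynomial.aeval (MvPolynomial.C (-b) * MvPolynomial.X 0 +
      MvPolynomial.C a * MvPolynomial.X 1) s, ?_, ?_, ?_⟩
  · refine (MvPolynomial.totalDegree_mul _ _).trans ?_
    have h1 := totalDegree_polynomial_aeval_le q (totalDegree_linear_le a b)
    have h2 := totalDegree_polynomial_aeval_le s (totalDegree_linear_le (-b) a)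
    lia
  · simp only [map_mul, eval_polynomial_aeval, map_add, MvPolynomial.eval_C, MvPolynomial.eval_X,
      hz0, hz1]
    rw [show a * (a * r) + b * (b * r) = r by linear_combination r * hab,
      show -b * (a * r) + a * (b * r) = 0 by ring, hq1, hs1, one_mul]
  · simp only [map_mul, eval_polynomial_aeval, map_add, MvPolynomial.eval_C, MvPolynomial.eval_X]
    rw [setIntegral_ballE_eq hab
      (fun u v => (q.eval (a * u + b * v) * s.eval (-b * u + a * v)) ^ 2)]
    have e1 : ∀ w : ℝ × ℝ, a * (a * w.1 - b * w.2) + b * (b * w.1 + a * w.2) = w.1 := fun w => by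
      linear_combination w.1 * hab
    have e2 : ∀ w : ℝ × ℝ, -b * (a * w.1 - b * w.2) + a * (b * w.1 + a * w.2) = w.2 := fun w => by
      linear_combination w.2 * hab
    simp only [e1, e2, mul_pow]
    have hsub : {w : ℝ × ℝ | w.1 ^ 2 + w.2 ^ 2 ≤ 1} ⊆ Icc (-1 : ℝ) 1 ×ˢ Icc (-1 : ℝ) 1 := by
      intro w hw
      have hw : w.1 ^ 2 + w.2 ^ 2 ≤ 1 := hw
      exact ⟨⟨by nlinarith, by nlinarith⟩, ⟨by nlinarith, by nlinarith⟩⟩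
    have hcont : Continuous fun w : ℝ × ℝ => q.eval w.1 ^ 2 * s.eval w.2 ^ 2 := by
      fun_prop
    have hle : ∫ w in {w : ℝ × ℝ | w.1 ^ 2 + w.2 ^ 2 ≤ 1}, q.eval w.1 ^ 2 * s.eval w.2 ^ 2 ≤
        ∫ w in Icc (-1 : ℝ) 1 ×ˢ Icc (-1 : ℝ) 1, q.eval w.1 ^ 2 * s.eval w.2 ^ 2 := by
      refine setIntegral_mono_set
        (hcont.continuousOn.integrableOn_compact (isCompact_Icc.prod isCompact_Icc)) ?_
        hsub.eventuallyLE
      exact Filter.Eventually.of_forall fun w => by positivity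
    refine hle.trans ?_
    rw [Measure.volume_eq_prod,
      setIntegral_prod_mul (fun x => q.eval x ^ 2) (fun y => s.eval y ^ 2),
      integral_Icc_eq_integral_Ioc, integral_Icc_eq_integral_Ioc,
      ← intervalIntegral.integral_of_le (by norm_num),
      ← intervalIntegral.integral_of_le (by norm_num)]
    have hsq : √(1 - r ^ 2) ≤ 2 * √(1 - r) := by
      rw [show (2 : ℝ) * √(1 - r) = √(4 * (1 - r)) by
        rw [Real.sqrt_mul (by norm_num), show (4 : ℝ) = 2 ^ 2 by norm_num,
          Real.sqrt_sq (by norm_num)]]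
      exact Real.sqrt_le_sqrt (by nlinarith)
    have hm1 : (m : ℝ)⁻¹ ≤ 1 := Nat.cast_inv_le_one m
    have hq' : ∫ x in (-1)..1, q.eval x ^ 2 ≤ 4 * Real.pi * (2 * (n : ℝ)⁻¹) * (34 * √(1 - r)) := by
      refine hq.trans ?_
      rw [div_eq_mul_inv, div_eq_mul_inv]
      gcongr
      linarith
    have hs' : ∫ x in (-1)..1, s.eval x ^ 2 ≤ 4 * Real.pi * (2 * (n : ℝ)⁻¹) * 3 := by
      refine hs.trans ?_
      rw [div_eq_mul_inv, div_eq_mul_inv]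
      gcongr
      norm_num
      linarith
    have hs0 : 0 ≤ ∫ x in (-1)..1, s.eval x ^ 2 :=
      intervalIntegral.integral_nonneg (by norm_num) fun x _ => by positivity
    refine (mul_le_mul hq' hs' hs0 (by positivity)).trans ?_
    have hpi : Real.pi ^ 2 ≤ 10 := by nlinarith [Real.pi_lt_d2, Real.pi_pos]
    calc 4 * Real.pi * (2 * (n : ℝ)⁻¹) * (34 * √(1 - r)) * (4 * Real.pi * (2 * (n : ℝ)⁻¹) * 3)
        = 6528 * Real.pi ^ 2 * (((n : ℝ) ^ 2)⁻¹ * √(1 - r)) := by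
          rw [← inv_pow]
          ring
      _ ≤ 70000 * (((n : ℝ) ^ 2)⁻¹ * √(1 - r)) := by
          gcongr
          linarith
      _ = _ := by ring

lemma pi_mul_integral_diameter_le {n : ℕ} {p : MvPolynomial (Fin 2) ℝ} (hp : p.totalDegree ≤ n)
    {a b : ℝ} (hab : a ^ 2 + b ^ 2 = 1) :
    Real.pi * ∫ t in (-1)..1, MvPolynomial.eval ![a * t, b * t] p ^ 2 ≤
      (2 * n + 3) * ∫ y in ballE, (MvPolynomial.eval (fun i => y i) p) ^ 2 := by
  have hev : Continuous fun x : Fin 2 → ℝ => MvPolynomial.eval x p :=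
    MvPolynomial.continuous_eval p
  have hvec : ∀ {X : Type} [TopologicalSpace X] {f g : X → ℝ}, Continuous f → Continuous g →
      Continuous fun x => MvPolynomial.eval ![f x, g x] p := by
    intro X _ f g hf hg
    refine hev.comp (continuous_pi fun i => ?_)
    fin_cases i
    exacts [hf, hg]
  simp only [eval_coords]
  rw [setIntegral_ballE_eq hab (fun u v => MvPolynomial.eval ![u, v] p ^ 2)]
  have hdisc := two_mul_setIntegral_disc_eq
    (F := fun x y => MvPolynomial.eval ![a * x - b * y, b * x + a * y] p ^ 2)
    ((hvec (by fun_prop) (by fun_prop)).pow 2)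
  set I := ∫ w in {w : ℝ × ℝ | w.1 ^ 2 + w.2 ^ 2 ≤ 1},
    MvPolynomial.eval ![a * w.1 - b * w.2, b * w.1 + a * w.2] p ^ 2
  set G : ℝ → ℝ → ℝ := fun t α => MvPolynomial.eval
    ![a * (t * Real.sin α) - b * Real.cos α, b * (t * Real.sin α) + a * Real.cos α] p ^ 2 *
      Real.sin α ^ 2 with hG
  have hGc : Continuous (Function.uncurry G) := by
    refine ((hvec ?_ ?_).pow 2).mul ?_ <;> fun_prop
  have hpoint : ∀ t : ℝ, 2 * Real.pi * MvPolynomial.eval ![a * t, b * t] p ^ 2 ≤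
      (2 * n + 3) * ∫ α in (-Real.pi)..Real.pi, G t α := by
    intro t
    have h0 : TrigPoly n (fun α => MvPolynomial.eval
        ![a * (t * Real.sin α) - b * Real.cos α, b * (t * Real.sin α) + a * Real.cos α] p) := by
      refine TrigPoly.eval_mvPolynomial p hp fun i => ?_
      fin_cases i
      · simpa [sub_eq_add_neg] using
          ((TrigPoly.sin.const_mul t).const_mul a).add (TrigPoly.cos.const_mul (-b))
      · exact ((TrigPoly.sin.const_mul t).const_mul b).add (TrigPoly.cos.const_mul a)
    have := (h0.mul TrigPoly.sin).sq_le_integral (Real.pi / 2)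
    simp only [Real.sin_pi_div_two, Real.cos_pi_div_two, mul_one, mul_zero, sub_zero, add_zero,
      mul_pow] at this
    refine this.trans (le_of_eq ?_)
    push_cast
    ring
  have hle : ∫ t in (-1)..1, 2 * Real.pi * MvPolynomial.eval ![a * t, b * t] p ^ 2 ≤
      ∫ t in (-1)..1, (2 * n + 3) * ∫ α in (-Real.pi)..Real.pi, G t α := by
    refine intervalIntegral.integral_mono_on (by norm_num) ?_ ?_ fun t _ => hpoint t
    · exact (((hvec (by fun_prop) (by fun_prop)).pow 2).const_mul _).intervalIntegrable _ _
    · exact ((intervalIntegral.continuous_parametric_intervalIntegral_of_continuous' hGc _ _).const_mul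
        _).intervalIntegrable _ _
  rw [intervalIntegral.integral_const_mul, intervalIntegral.integral_const_mul,
    intervalIntegral_intervalIntegral_swap, ← hdisc] at hle
  · linarith
  · exact (hGc.continuousOn.integrableOn_compact (isCompact_uIcc.prod isCompact_uIcc)).mono_set
      (prod_mono uIoc_subset_uIcc uIoc_subset_uIcc)

lemma christoffel_ball_lower {n : ℕ} (hn : 1 ≤ n) {z : E2}
    (hz : ‖z‖ ≤ 1 - (64 * (n : ℝ) ^ 2)⁻¹) {p : MvPolynomial (Fin 2) ℝ} (hp : p.totalDegree ≤ n)
    (hp1 : MvPolynomial.eval (fun i => z i) p = 1) :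
    ((n : ℝ) ^ 2)⁻¹ * √(1 - ‖z‖) ≤
      70000 * ∫ y in ballE, (MvPolynomial.eval (fun i => y i) p) ^ 2 := by
  obtain ⟨a, b, hab, hz0, hz1⟩ := exists_polar z
  have hn1 : (1 : ℝ) ≤ n := by exact_mod_cast hn
  have hδ := inv_le_mul_sqrt hz
  have hr0 := norm_nonneg z
  have hr1 : ‖z‖ < 1 := hz.trans_lt (sub_lt_self _ (by positivity))
  have hdiam := pi_mul_integral_diameter_le hp hab
  rw [eval_coords, hz0, hz1] at hp1
  set r := ‖z‖ with hr
  set I := ∫ y in ballE, (MvPolynomial.eval (fun i => y i) p) ^ 2 with hI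
  have hI0 : 0 ≤ I := integral_nonneg fun y => sq_nonneg _
  have hsq : √(1 - r) ≤ √(1 - r ^ 2) := Real.sqrt_le_sqrt (by nlinarith)
  have hcont : Continuous fun t : ℝ => MvPolynomial.eval ![a * t, b * t] p := by
    refine (MvPolynomial.continuous_eval p).comp (continuous_pi fun i => ?_)
    fin_cases i
    exacts [continuous_const_mul a, continuous_const_mul b]
  have htrig : TrigPoly n (fun θ => MvPolynomial.eval ![a * Real.cos θ, b * Real.cos θ] p) := by
    refine TrigPoly.eval_mvPolynomial p hp fun i => ?_
    fin_cases i
    exacts [TrigPoly.cos.const_mul a, TrigPoly.cos.const_mul b]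
  have hline := sq_mul_sqrt_le_integral hn hcont (t := r) (K := 16)
    htrig ⟨by linarith, hr1⟩ (by rw [div_eq_mul_inv]; linarith)
  rw [hp1, one_pow, one_mul] at hline
  set J := ∫ t in (-1)..1, MvPolynomial.eval ![a * t, b * t] p ^ 2 with hJ
  have hJ0 : 0 ≤ J := intervalIntegral.integral_nonneg (by norm_num) fun x _ => by positivity
  clear_value I J
  have hpi : 1 ≤ Real.pi := by linarith [Real.pi_gt_three]
  have h1 : J ≤ 5 * n * I := by
    calc J ≤ Real.pi * J := le_mul_of_one_le_left hJ0 hpi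
      _ ≤ (2 * n + 3) * I := hdiam
      _ ≤ 5 * n * I := mul_le_mul_of_nonneg_right (by linarith) hI0
  have h2 : √(1 - r) ≤ 85 * n * J := by
    calc √(1 - r) ≤ √(1 - r ^ 2) := hsq
      _ ≤ Real.pi * √(1 - r ^ 2) := le_mul_of_one_le_left (Real.sqrt_nonneg _) hpi
      _ ≤ (4 * n + 1) * (1 + 16) * J := hline
      _ ≤ 85 * n * J := mul_le_mul_of_nonneg_right (by linarith) hJ0
  rw [inv_mul_le_iff₀ (by positivity)]
  calc √(1 - r) ≤ 85 * n * J := h2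
    _ ≤ 85 * n * (5 * n * I) := by gcongr
    _ = n ^ 2 * (425 * I) := by ring
    _ ≤ n ^ 2 * (70000 * I) := by gcongr; norm_num

/-- Behavior of the Christoffel function on the unit disk. -/
theorem stmt13 : ∃ c : ℝ, 1 ≤ c ∧ ∀ n : ℕ, 1 ≤ n → ∀ z : E2,
    ‖z‖ ≤ 1 - (64 * (n:ℝ)^2)⁻¹ →
    c⁻¹ * ((n:ℝ)^2)⁻¹ * Real.sqrt (1 - ‖z‖) ≤ christoffel 2 n z ballE ∧
    christoffel 2 n z ballE ≤ c * ((n:ℝ)^2)⁻¹ * Real.sqrt (1 - ‖z‖) := by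
  refine ⟨70000, by norm_num, fun n hn z hz => ⟨?_, ?_⟩⟩
  · refine le_csInf ⟨_, MvPolynomial.C 1, by simp, by simp, rfl⟩ ?_
    rintro _ ⟨p, hdeg, hp1, rfl⟩
    have h := christoffel_ball_lower hn hz hdeg hp1
    rw [mul_assoc, inv_mul_le_iff₀ (by norm_num)]
    exact h
  · obtain ⟨p, hdeg, hp1, hp⟩ := christoffel_ball_upper hn hz
    refine le_trans (csInf_le ⟨0, ?_⟩ ⟨p, hdeg, hp1, rfl⟩) hp
    rintro _ ⟨p, -, -, rfl⟩
    exact integral_nonneg fun y => sq_nonneg _
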